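/- For every k ≥ 1 and every generalized atom A_Q that is definable in Σ¹₁(FOC^k), every sentence of FO^k(A_Q) is equivalent to a sentence of Σ¹₁(FOC^k): for each sentence φ of FO^k(A_Q) over a relational vocabulary τ there exists a sentence φ' of the form ∃R_1⋯∃R_n χ, with R_1,...,R_n relation symbols of arity at most k and χ a sentence of k-variable first-order logic with counting quantifiers over τ ∪ {R_1,...,R_n}, such that for every τ-structure 𝔄: 𝔄 ⊨ φ (team semantics) iff 𝔄 ⊨ φ' (Tarskian second-order semantics). -/

import Mathlib

/-- A relational signature: a type of relation symbols with arities. -/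
structure Signature : Type 1 where
  Rel : Type
  arity : Rel → ℕ

/-- A relational structure over a signature. -/
structure Struc (σ : Signature) : Type 1 where
  A : Type
  interp : (r : σ.Rel) → (Fin (σ.arity r) → A) → Prop

/-- A generalized atom of type `(ty 0, ..., ty (t-1))`, given by a generalized
quantifier `Q`: a class of structures `(A, B_1, ..., B_t)` with `B_j ⊆ A^{ty j}`. -/
structure GenAtom : Type 1 where
  t : ℕ
  ty : Fin t → ℕ
  Q : (A : Type) → ((j : Fin t) → Set (Fin (ty j) → A)) → Prop

/-- Formulas of `FO(𝒜)` in negation normal form. Variables are natural numbers;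
`ga : ι → GenAtom` is the collection 𝒜 of generalized atoms. -/
inductive Fml (σ : Signature) {ι : Type} (ga : ι → GenAtom) : Type where
  | rel (r : σ.Rel) (v : Fin (σ.arity r) → ℕ)
  | nrel (r : σ.Rel) (v : Fin (σ.arity r) → ℕ)
  | eq (m n : ℕ)
  | neq (m n : ℕ)
  | and (φ ψ : Fml σ ga)
  | or (φ ψ : Fml σ ga)
  | ex (x : ℕ) (φ : Fml σ ga)
  | all (x : ℕ) (φ : Fml σ ga)
  | atom (i : ι) (v : (j : Fin (ga i).t) → Fin ((ga i).ty j) → ℕ)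

/-- The updated assignment `s[a/x]`. -/
def upd {A : Type} (s : ℕ → A) (x : ℕ) (a : A) : ℕ → A :=
  fun n => if n = x then a else s n

/-- `rel(X, ȳ)`: the relation that a team `X` induces via a tuple `v` of variables. -/
def relOf {A : Type} (X : Set (ℕ → A)) {m : ℕ} (v : Fin m → ℕ) : Set (Fin m → A) :=
  (fun s => fun k => s (v k)) '' X

variable {σ : Signature} {ι : Type} {ga : ι → GenAtom}

/-- Lax team semantics for `FO(𝒜)`. A team is a set of assignments `ℕ → M.A`. -/
def TSat (M : Struc σ) : Fml σ ga → Set (ℕ → M.A) → Prop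
  | .rel r v, X => ∀ s ∈ X, M.interp r (fun k => s (v k))
  | .nrel r v, X => ∀ s ∈ X, ¬ M.interp r (fun k => s (v k))
  | .eq m n, X => ∀ s ∈ X, s m = s n
  | .neq m n, X => ∀ s ∈ X, s m ≠ s n
  | .and φ ψ, X => TSat M φ X ∧ TSat M ψ X
  | .or φ ψ, X => ∃ Y Z, X = Y ∪ Z ∧ TSat M φ Y ∧ TSat M ψ Z
  | .ex x φ, X => ∃ F : (ℕ → M.A) → Set M.A, (∀ s ∈ X, (F s).Nonempty) ∧
      TSat M φ {s' | ∃ s ∈ X, ∃ a ∈ F s, s' = upd s x a}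
  | .all x φ, X => TSat M φ {s' | ∃ s ∈ X, ∃ a : M.A, s' = upd s x a}
  | .atom i v, X => (ga i).Q M.A (fun j => relOf X (v j))

/-- The set of free variables of a formula. -/
def Fr : Fml σ ga → Set ℕ
  | .rel _ v => Set.range v
  | .nrel _ v => Set.range v
  | .eq m n => {m, n}
  | .neq m n => {m, n}
  | .and φ ψ => Fr φ ∪ Fr ψ
  | .or φ ψ => Fr φ ∪ Fr ψ
  | .ex x φ => Fr φ \ {x}
  | .all x φ => Fr φ \ {x}
  | .atom _ v => ⋃ j, Set.range (v j)

/-- The set of all variables occurring in a formula (free or bound). -/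
def Vars : Fml σ ga → Set ℕ
  | .rel _ v => Set.range v
  | .nrel _ v => Set.range v
  | .eq m n => {m, n}
  | .neq m n => {m, n}
  | .and φ ψ => Vars φ ∪ Vars ψ
  | .or φ ψ => Vars φ ∪ Vars ψ
  | .ex x φ => insert x (Vars φ)
  | .all x φ => insert x (Vars φ)
  | .atom _ v => ⋃ j, Set.range (v j)

/-- Truth of a sentence `φ` in a structure `M`: satisfaction by the team of all
assignments, which (for sentences, by locality) represents satisfaction by the
team `{∅}` containing only the empty assignment. -/
def TTrue (M : Struc σ) (φ : Fml σ ga) : Prop :=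
  TSat M φ (Set.univ : Set (ℕ → M.A))

/-- Formulas of first-order logic with counting quantifiers `∃^{≥i}`
(`count i x φ` means `∃^{≥i} x φ`), with ordinary Tarskian semantics. -/
inductive CFml (σ : Signature) : Type where
  | rel (r : σ.Rel) (v : Fin (σ.arity r) → ℕ)
  | eq (m n : ℕ)
  | not (φ : CFml σ)
  | and (φ ψ : CFml σ)
  | or (φ ψ : CFml σ)
  | ex (x : ℕ) (φ : CFml σ)
  | all (x : ℕ) (φ : CFml σ)
  | count (i : ℕ) (x : ℕ) (φ : CFml σ)

/-- Tarskian satisfaction for `FOC`-formulas; `∃^{≥i} x φ` holds iff at least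
`i` elements `a` satisfy `φ(a/x)`. -/
def CSat {σ : Signature} (M : Struc σ) : CFml σ → (ℕ → M.A) → Prop
  | .rel r v, s => M.interp r (fun k => s (v k))
  | .eq m n, s => s m = s n
  | .not φ, s => ¬ CSat M φ s
  | .and φ ψ, s => CSat M φ s ∧ CSat M ψ s
  | .or φ ψ, s => CSat M φ s ∨ CSat M ψ s
  | .ex x φ, s => ∃ a, CSat M φ (upd s x a)
  | .all x φ, s => ∀ a, CSat M φ (upd s x a)
  | .count i x φ, s => ∃ S : Finset M.A, i ≤ S.card ∧ ∀ a ∈ S, CSat M φ (upd s x a)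

/-- The variables occurring in an `FOC`-formula. -/
def CVars {σ : Signature} : CFml σ → Set ℕ
  | .rel _ v => Set.range v
  | .eq m n => {m, n}
  | .not φ => CVars φ
  | .and φ ψ => CVars φ ∪ CVars ψ
  | .or φ ψ => CVars φ ∪ CVars ψ
  | .ex x φ => insert x (CVars φ)
  | .all x φ => insert x (CVars φ)
  | .count _ x φ => insert x (CVars φ)

/-- The signature `σ` expanded by `n` fresh relation symbols of arities `ar`. -/
def expandSig (σ : Signature) (n : ℕ) (ar : Fin n → ℕ) : Signature :=
  ⟨σ.Rel ⊕ Fin n, Sum.elim σ.arity ar⟩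

/-- The expansion of `M` interpreting the `n` fresh relation symbols by `R`. -/
def expandStruc {σ : Signature} (M : Struc σ) (n : ℕ) (ar : Fin n → ℕ)
    (R : (i : Fin n) → Set (Fin (ar i) → M.A)) : Struc (expandSig σ n ar) :=
  ⟨M.A, fun r => match r with
    | .inl r₀ => M.interp r₀
    | .inr i => fun w => w ∈ R i⟩

/-- The signature consisting of the relation symbols `R_1, ..., R_t` of a
generalized atom of type `(ty 0, ..., ty (t-1))`. -/
def atomSig (G : GenAtom) : Signature := ⟨Fin G.t, G.ty⟩

/-- The `atomSig G`-structure with domain `A` interpreting `R_j` as `Rfam j`. -/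
def atomStruc (G : GenAtom) (A : Type)
    (Rfam : (j : Fin G.t) → Set (Fin (G.ty j) → A)) : Struc (atomSig G) :=
  ⟨A, fun j w => w ∈ Rfam j⟩

/-- A generalized atom `A_Q` is definable in `Σ¹₁(FOC^k)` if there is a
sentence `∃S_1⋯∃S_m χ` with `χ ∈ FOC^k` over the vocabulary
`{R_1,...,R_t, S_1,...,S_m}` (all arities of the `S_i` at most `k`, all
variables of `χ` among `x_1,...,x_k`, i.e. `0,...,k-1`) defining the
quantifier `Q`: for every nonempty domain `A` and relations `Rfam`,
`Q` holds of `(A, Rfam)` iff the sentence is true in `(A, Rfam)`. -/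
def DefinableAtom (G : GenAtom) (k : ℕ) : Prop :=
  ∃ (m : ℕ) (ar : Fin m → ℕ), (∀ i, ar i ≤ k) ∧
    ∃ χ : CFml (expandSig (atomSig G) m ar), CVars χ ⊆ {n : ℕ | n < k} ∧
      ∀ (A : Type), Nonempty A →
        ∀ Rfam : (j : Fin G.t) → Set (Fin (G.ty j) → A),
          (G.Q A Rfam ↔
            ∃ S : (i : Fin m) → Set (Fin (ar i) → A),
              ∀ s : ℕ → A, CSat (expandStruc (atomStruc G A Rfam) m ar S) χ s)

namespace CFml

/-- Renaming of relation symbols along an arity-preserving map. -/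
def mapRel {τ τ' : Signature} (f : τ.Rel → τ'.Rel) (h : ∀ r, τ'.arity (f r) = τ.arity r) :
    CFml τ → CFml τ'
  | .rel r v => .rel (f r) (fun i => v (Fin.cast (h r) i))
  | .eq m n => .eq m n
  | .not φ => .not (mapRel f h φ)
  | .and φ ψ => .and (mapRel f h φ) (mapRel f h ψ)
  | .or φ ψ => .or (mapRel f h φ) (mapRel f h ψ)
  | .ex x φ => .ex x (mapRel f h φ)
  | .all x φ => .all x (mapRel f h φ)
  | .count i x φ => .count i x (mapRel f h φ)

end CFml

/-- The reduct of a structure along an arity-preserving map of relation symbols. -/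
def Struc.reduct {τ τ' : Signature} (f : τ.Rel → τ'.Rel)
    (h : ∀ r, τ'.arity (f r) = τ.arity r) (N : Struc τ') : Struc τ :=
  ⟨N.A, fun r w => N.interp (f r) (fun i => w (Fin.cast (h r) i))⟩

theorem cVars_mapRel {τ τ' : Signature} (f : τ.Rel → τ'.Rel)
    (h : ∀ r, τ'.arity (f r) = τ.arity r) (φ : CFml τ) :
    CVars (φ.mapRel f h) ⊆ CVars φ := by
  induction φ with
  | rel r v =>
    rintro _ ⟨i, rfl⟩
    exact ⟨_, rfl⟩
  | eq m n => exact subset_rfl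
  | not φ ih => exact ih
  | and φ ψ ih₁ ih₂ => exact Set.union_subset_union ih₁ ih₂
  | or φ ψ ih₁ ih₂ => exact Set.union_subset_union ih₁ ih₂
  | ex x φ ih => exact Set.insert_subset_insert ih
  | all x φ ih => exact Set.insert_subset_insert ih
  | count i x φ ih => exact Set.insert_subset_insert ih

theorem cSat_mapRel {τ τ' : Signature} (f : τ.Rel → τ'.Rel)
    (h : ∀ r, τ'.arity (f r) = τ.arity r) (N : Struc τ') (φ : CFml τ) (s : ℕ → N.A) :
    CSat N (φ.mapRel f h) s ↔ CSat (N.reduct f h) φ s := by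
  induction φ generalizing s with
  | rel r v => exact Iff.rfl
  | eq m n => exact Iff.rfl
  | not φ ih => exact not_congr (ih s)
  | and φ ψ ih₁ ih₂ => exact and_congr (ih₁ s) (ih₂ s)
  | or φ ψ ih₁ ih₂ => exact or_congr (ih₁ s) (ih₂ s)
  | ex x φ ih => exact exists_congr fun a => ih _
  | all x φ ih => exact forall_congr' fun a => ih _
  | count i x φ ih =>
    exact exists_congr fun S => and_congr Iff.rfl
      (forall_congr' fun a => forall_congr' fun _ => ih _)

/-- A family of relations on `A`, one for each arity at most `k`. -/
abbrev RelFam (k : ℕ) (A : Type) : Type := (m : Fin (k + 1)) → Set (Fin m → A)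

/-- The expansion of `σ` by relation symbols `(j, m)` of arity `m ≤ k`, for `j : J`. -/
def famSig (σ : Signature) (k : ℕ) (J : Type) : Signature :=
  ⟨σ.Rel ⊕ (J × Fin (k + 1)), Sum.elim σ.arity (fun p => (p.2 : ℕ))⟩

/-- The expansion of `M` interpreting the symbols `(j, m)` by `R j m`. -/
def famStruc {σ : Signature} {k : ℕ} {J : Type} (M : Struc σ) (R : J → RelFam k M.A) :
    Struc (famSig σ k J) :=
  ⟨M.A, fun r => match r with
    | .inl r₀ => M.interp r₀
    | .inr p => fun w => w ∈ R p.1 p.2⟩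

/-- Definability of a property of relation families and assignments by a formula of `FOC^k`. -/
def FODef (σ : Signature) (k : ℕ) (J : Type)
    (D : (M : Struc σ) → (J → RelFam k M.A) → (ℕ → M.A) → Prop) : Prop :=
  ∃ χ : CFml (famSig σ k J), CVars χ ⊆ {n : ℕ | n < k} ∧
    ∀ (M : Struc σ) (R : J → RelFam k M.A) (s : ℕ → M.A), CSat (famStruc M R) χ s ↔ D M R s

namespace FODef

variable {τ : Signature} {k : ℕ} {J : Type}
  {D E : (M : Struc τ) → (J → RelFam k M.A) → (ℕ → M.A) → Prop}

theorem rel (r : τ.Rel) (v : Fin (τ.arity r) → ℕ) (hv : ∀ i, v i < k) :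
    FODef τ k J (fun M _ s => M.interp r (fun i => s (v i))) :=
  ⟨.rel (σ := famSig τ k J) (.inl r) v, by rintro _ ⟨i, rfl⟩; exact hv i,
    fun _ _ _ => Iff.rfl⟩

theorem mem (j : J) (m : Fin (k + 1)) (v : Fin m → ℕ) (hv : ∀ i, v i < k) :
    FODef τ k J (fun _ R s => (fun i => s (v i)) ∈ R j m) :=
  ⟨.rel (σ := famSig τ k J) (.inr (j, m)) v, by rintro _ ⟨i, rfl⟩; exact hv i,
    fun _ _ _ => Iff.rfl⟩

theorem eq {m n : ℕ} (hm : m < k) (hn : n < k) :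
    FODef τ k J (fun _ _ s => s m = s n) :=
  ⟨.eq m n, by rintro _ (rfl | rfl) <;> assumption, fun _ _ _ => Iff.rfl⟩

theorem not (hD : FODef τ k J D) : FODef τ k J (fun M R s => ¬ D M R s) := by
  obtain ⟨χ, hv, h⟩ := hD
  exact ⟨.not χ, hv, fun M R s => not_congr (h M R s)⟩

theorem and (hD : FODef τ k J D) (hE : FODef τ k J E) :
    FODef τ k J (fun M R s => D M R s ∧ E M R s) := by
  obtain ⟨χ, hv, h⟩ := hD
  obtain ⟨χ', hv', h'⟩ := hE
  exact ⟨.and χ χ', Set.union_subset hv hv', fun M R s => and_congr (h M R s) (h' M R s)⟩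

theorem or (hD : FODef τ k J D) (hE : FODef τ k J E) :
    FODef τ k J (fun M R s => D M R s ∨ E M R s) := by
  obtain ⟨χ, hv, h⟩ := hD
  obtain ⟨χ', hv', h'⟩ := hE
  exact ⟨.or χ χ', Set.union_subset hv hv', fun M R s => or_congr (h M R s) (h' M R s)⟩

theorem congr (hD : FODef τ k J D) (h : ∀ M R s, D M R s ↔ E M R s) : FODef τ k J E := by
  obtain ⟨χ, hv, hχ⟩ := hD
  exact ⟨χ, hv, fun M R s => (hχ M R s).trans (h M R s)⟩

theorem imp (hD : FODef τ k J D) (hE : FODef τ k J E) :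
    FODef τ k J (fun M R s => D M R s → E M R s) :=
  (hD.not.or hE).congr fun _ _ _ => imp_iff_not_or.symm

theorem iff (hD : FODef τ k J D) (hE : FODef τ k J E) :
    FODef τ k J (fun M R s => D M R s ↔ E M R s) :=
  ((hD.imp hE).and (hE.imp hD)).congr fun _ _ _ => iff_def.symm

theorem ex {x : ℕ} (hx : x < k) (hD : FODef τ k J D) :
    FODef τ k J (fun M R s => ∃ a, D M R (upd s x a)) := by
  obtain ⟨χ, hv, h⟩ := hD
  exact ⟨.ex x χ, Set.insert_subset hx hv, fun M R s => exists_congr fun a => h M R _⟩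

theorem exFinset (T : Finset ℕ) (hT : ∀ x ∈ T, x < k) (hD : FODef τ k J D) :
    FODef τ k J (fun M R s => ∃ s', (∀ n, n ∉ T → s' n = s n) ∧ D M R s') := by
  induction T using Finset.induction_on with
  | empty =>
    refine hD.congr fun M R s => ⟨fun h => ⟨s, fun _ _ => rfl, h⟩, ?_⟩
    rintro ⟨s', h, hD⟩
    obtain rfl : s' = s := funext fun n => h n (by simp)
    exact hD
  | insert x T _ ih =>
    refine ((ih fun y hy => hT y (Finset.mem_insert_of_mem hy)).ex
      (hT x (Finset.mem_insert_self _ _))).congr fun M R s => ⟨?_, ?_⟩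
    · rintro ⟨a, s', h, hs'⟩
      refine ⟨s', fun n hn => ?_, hs'⟩
      rw [Finset.mem_insert, not_or] at hn
      rw [h n hn.2, upd, if_neg hn.1]
    · rintro ⟨s', h, hs'⟩
      refine ⟨s' x, s', fun n hn => ?_, hs'⟩
      by_cases hnx : n = x
      · simp [upd, hnx]
      · rw [upd, if_neg hnx, h n (by simp [hnx, hn])]

theorem true (hk : 0 < k) : FODef τ k J (fun _ _ _ => True) :=
  (FODef.eq hk hk).congr fun _ _ _ => by simp

theorem constImp (hk : 0 < k) (c : Prop) (hD : c → FODef τ k J D) :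
    FODef τ k J (fun M R s => c → D M R s) := by
  by_cases hc : c
  · exact (hD hc).congr fun _ _ _ => by simp [hc]
  · exact (FODef.true hk).congr fun _ _ _ => by simp [hc]

theorem forallFinite (hk : 0 < k) {α : Type} [Finite α]
    {D : α → (M : Struc τ) → (J → RelFam k M.A) → (ℕ → M.A) → Prop}
    (hD : ∀ i, FODef τ k J (D i)) : FODef τ k J (fun M R s => ∀ i, D i M R s) := by
  have := Fintype.ofFinite α
  have key : ∀ T : Finset α, FODef τ k J (fun M R s => ∀ i ∈ T, D i M R s) := by
    classical
    intro T
    induction T using Finset.induction_on with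
    | empty => exact (FODef.true hk).congr fun _ _ _ => by simp
    | insert i T _ ih =>
      exact ((hD i).and ih).congr fun _ _ _ => by simp
  exact (key Finset.univ).congr fun _ _ _ => by simp

theorem rename {J' : Type} (f : J → J') (hD : FODef τ k J D) :
    FODef τ k J' (fun M R s => D M (fun j => R (f j)) s) := by
  obtain ⟨χ, hv, h⟩ := hD
  let g : (famSig τ k J).Rel → (famSig τ k J').Rel := Sum.map id (Prod.map f id)
  have hg : ∀ r, (famSig τ k J').arity (g r) = (famSig τ k J).arity r := by
    rintro (r | p) <;> rfl
  refine ⟨χ.mapRel g hg, (cVars_mapRel g hg χ).trans hv, fun M R s => ?_⟩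
  refine (cSat_mapRel g hg (famStruc M R) χ s).trans (Iff.trans ?_ (h M _ s))
  refine iff_of_eq (congrArg
    (fun I => CSat (Struc.mk (σ := famSig τ k J) M.A I) χ s) (funext ?_))
  rintro (r | p) <;> rfl

end FODef

/-- Definability of a property of relation families by a formula of `Σ¹₁(FOC^k)`. -/
def SODef (σ : Signature) (k : ℕ) (J : Type)
    (P : (M : Struc σ) → (J → RelFam k M.A) → Prop) : Prop :=
  ∃ (I : Type) (_ : Finite I)
    (D : (M : Struc σ) → (J ⊕ I → RelFam k M.A) → (ℕ → M.A) → Prop), FODef σ k (J ⊕ I) D ∧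
    ∀ M : Struc σ, Nonempty M.A → ∀ R : J → RelFam k M.A,
      (P M R ↔ ∃ S : I → RelFam k M.A, ∀ s, D M (Sum.elim R S) s)

namespace SODef

variable {τ : Signature} {k : ℕ} {J : Type}
  {P Q : (M : Struc τ) → (J → RelFam k M.A) → Prop}

theorem ofFODef {D : (M : Struc τ) → (J → RelFam k M.A) → (ℕ → M.A) → Prop}
    (hD : FODef τ k J D) : SODef τ k J (fun M R => ∀ s, D M R s) :=
  ⟨Empty, inferInstance, _, hD.rename Sum.inl, fun _ _ _ =>
    ⟨fun h => ⟨Empty.elim, h⟩, fun ⟨_, h⟩ => h⟩⟩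

theorem congr (hP : SODef τ k J P)
    (h : ∀ M : Struc τ, Nonempty M.A → ∀ R, P M R ↔ Q M R) : SODef τ k J Q := by
  obtain ⟨I, hI, D, hD, hPD⟩ := hP
  exact ⟨I, hI, D, hD, fun M hM R => (h M hM R).symm.trans (hPD M hM R)⟩

theorem and (hP : SODef τ k J P) (hQ : SODef τ k J Q) :
    SODef τ k J (fun M R => P M R ∧ Q M R) := by
  obtain ⟨I, hI, D, hD, hPD⟩ := hP
  obtain ⟨I', hI', D', hD', hQD⟩ := hQ
  refine ⟨I ⊕ I', inferInstance, _,
    (hD.rename (Sum.map id Sum.inl)).and (hD'.rename (Sum.map id Sum.inr)), fun M hM R => ?_⟩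
  have h₁ (S : I ⊕ I' → RelFam k M.A) :
      (fun j => Sum.elim R S (Sum.map id Sum.inl j)) = Sum.elim R (fun i => S (.inl i)) := by
    funext j; cases j <;> rfl
  have h₂ (S : I ⊕ I' → RelFam k M.A) :
      (fun j => Sum.elim R S (Sum.map id Sum.inr j)) = Sum.elim R (fun i => S (.inr i)) := by
    funext j; cases j <;> rfl
  simp only [h₁, h₂, hPD M hM R, hQD M hM R]
  constructor
  · rintro ⟨⟨S, hS⟩, S', hS'⟩
    exact ⟨Sum.elim S S', fun s => ⟨hS s, hS' s⟩⟩
  · rintro ⟨S, hS⟩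
    exact ⟨⟨_, fun s => (hS s).1⟩, _, fun s => (hS s).2⟩

theorem rename {J' : Type} (f : J → J') (hP : SODef τ k J P) :
    SODef τ k J' (fun M R => P M (fun j => R (f j))) := by
  obtain ⟨I, hI, D, hD, hPD⟩ := hP
  refine ⟨I, hI, _, hD.rename (Sum.map f id), fun M hM R => ?_⟩
  refine (hPD M hM _).trans (exists_congr fun S => forall_congr' fun s => ?_)
  have : (fun j => Sum.elim R S (Sum.map f id j)) = Sum.elim (fun j => R (f j)) S := by
    funext j; cases j <;> rfl
  rw [this]

theorem ex {K : Type} [Finite K] {P : (M : Struc τ) → (J ⊕ K → RelFam k M.A) → Prop}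
    (hP : SODef τ k (J ⊕ K) P) :
    SODef τ k J (fun M R => ∃ T : K → RelFam k M.A, P M (Sum.elim R T)) := by
  obtain ⟨I, hI, D, hD, hPD⟩ := hP
  refine ⟨K ⊕ I, inferInstance, _, hD.rename (Equiv.sumAssoc J K I), fun M hM R => ?_⟩
  have h (S : K ⊕ I → RelFam k M.A) :
      (fun j => Sum.elim R S (Equiv.sumAssoc J K I j)) =
        Sum.elim (Sum.elim R (fun i => S (.inl i))) (fun i => S (.inr i)) := by
    funext j; rcases j with (j | j) | j <;> rfl
  simp only [h, hPD M hM]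
  constructor
  · rintro ⟨T, S, hS⟩
    exact ⟨Sum.elim T S, hS⟩
  · rintro ⟨S, hS⟩
    exact ⟨_, _, hS⟩

/-- Properties definable in `Σ¹₁(FOC^k)` without relation parameters are defined by an
actual `Σ¹₁(FOC^k)` sentence. -/
theorem exists_sentence {P : Struc τ → Prop} (hP : SODef τ k Empty (fun M _ => P M)) :
    ∃ (n : ℕ) (ar : Fin n → ℕ), (∀ i, ar i ≤ k) ∧
      ∃ χ : CFml (expandSig τ n ar), CVars χ ⊆ {n : ℕ | n < k} ∧
        ∀ M : Struc τ, Nonempty M.A →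
          (P M ↔ ∃ R : (i : Fin n) → Set (Fin (ar i) → M.A),
            ∀ s : ℕ → M.A, CSat (expandStruc M n ar R) χ s) := by
  obtain ⟨I, hI, D, ⟨χ, hv, hχ⟩, hPD⟩ := hP
  obtain ⟨n, ⟨e⟩⟩ := Finite.exists_equiv_fin ((Empty ⊕ I) × Fin (k + 1))
  let ar : Fin n → ℕ := fun i => ((e.symm i).2 : ℕ)
  let g : (famSig τ k (Empty ⊕ I)).Rel → (expandSig τ n ar).Rel := Sum.map id e
  have hg : ∀ r, (expandSig τ n ar).arity (g r) = (famSig τ k (Empty ⊕ I)).arity r := by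
    rintro (r | p)
    · rfl
    · change ((e.symm (e p)).2 : ℕ) = p.2
      rw [e.symm_apply_apply]
  refine ⟨n, ar, fun i => Nat.lt_succ_iff.1 (e.symm i).2.2, χ.mapRel g hg,
    (cVars_mapRel g hg χ).trans hv, fun M hM => ?_⟩
  have key (R : (i : Fin n) → Set (Fin (ar i) → M.A)) (S : Empty ⊕ I → RelFam k M.A)
      (h : ∀ p w, (fun i => w (Fin.cast (hg (.inr p)) i)) ∈ R (e p) ↔ w ∈ S p.1 p.2)
      (s : ℕ → M.A) :
      CSat (expandStruc M n ar R) (χ.mapRel g hg) s ↔ CSat (famStruc M S) χ s := by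
    refine (cSat_mapRel g hg (expandStruc M n ar R) χ s).trans ?_
    refine iff_of_eq (congrArg
      (fun I' => CSat (Struc.mk (σ := famSig τ k (Empty ⊕ I)) M.A I') χ s) (funext ?_))
    rintro (r | p)
    · rfl
    · exact funext fun w => propext (h p w)
  refine (hPD M hM Empty.elim).trans ?_
  constructor
  · rintro ⟨S, hS⟩
    refine ⟨fun i => Sum.elim Empty.elim S (e.symm i).1 (e.symm i).2, fun s =>
      (key _ (Sum.elim Empty.elim S) ?_ s).2 ((hχ M _ s).2 (hS s))⟩
    intro p w
    have : ∀ (q : (Empty ⊕ I) × Fin (k + 1)) (hq : q = p) (hc : (q.2 : ℕ) = p.2),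
        (fun i => w (Fin.cast hc i)) ∈ (Sum.elim Empty.elim S : _ → RelFam k M.A) q.1 q.2 ↔
          w ∈ (Sum.elim Empty.elim S : _ → RelFam k M.A) p.1 p.2 := by
      rintro q rfl hc
      exact Iff.rfl
    exact this _ (e.symm_apply_apply p) _
  · rintro ⟨R, hR⟩
    let S : Empty ⊕ I → RelFam k M.A := fun j m =>
      {w | (fun i => w (Fin.cast (hg (.inr (j, m))) i)) ∈ R (e (j, m))}
    have hS : Sum.elim Empty.elim (fun i => S (.inr i)) = S := by
      funext j; rcases j with j | j
      · exact j.elim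
      · rfl
    refine ⟨fun i => S (.inr i), fun s => ?_⟩
    rw [hS, ← hχ M]
    exact (key R S (fun _ _ => Iff.rfl) s).1 (hR s)

end SODef

/-- Two teams are equivalent if they have the same restriction to the first `k` variables. -/
def TeamEquiv {A : Type} (k : ℕ) (X Y : Set (ℕ → A)) : Prop :=
  (∀ s ∈ X, ∃ t ∈ Y, ∀ n < k, s n = t n) ∧ (∀ t ∈ Y, ∃ s ∈ X, ∀ n < k, s n = t n)

theorem TeamEquiv.symm {A : Type} {k : ℕ} {X Y : Set (ℕ → A)} (h : TeamEquiv k X Y) :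
    TeamEquiv k Y X :=
  ⟨fun t ht => (h.2 t ht).imp fun _ ⟨hs, e⟩ => ⟨hs, fun n hn => (e n hn).symm⟩,
    fun s hs => (h.1 s hs).imp fun _ ⟨ht, e⟩ => ⟨ht, fun n hn => (e n hn).symm⟩⟩

theorem upd_agree {A : Type} {k : ℕ} {s t : ℕ → A} (h : ∀ n < k, s n = t n) (x : ℕ) (a : A) :
    ∀ n < k, upd s x a n = upd t x a n := by
  intro n hn
  simp [upd, h n hn]

theorem TeamEquiv.relOf_eq {A : Type} {k : ℕ} {X Y : Set (ℕ → A)} (h : TeamEquiv k X Y)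
    {m : ℕ} {v : Fin m → ℕ} (hv : ∀ i, v i < k) : relOf X v = relOf Y v := by
  ext w
  constructor
  · rintro ⟨s, hs, rfl⟩
    obtain ⟨t, ht, e⟩ := h.1 s hs
    exact ⟨t, ht, funext fun i => (e _ (hv i)).symm⟩
  · rintro ⟨t, ht, rfl⟩
    obtain ⟨s, hs, e⟩ := h.2 t ht
    exact ⟨s, hs, funext fun i => e _ (hv i)⟩

/-- Locality of lax team semantics. -/
theorem TSat.of_teamEquiv {M : Struc σ} {k : ℕ} {φ : Fml σ ga}
    (hφ : Vars φ ⊆ {n : ℕ | n < k}) {X Y : Set (ℕ → M.A)} (h : TeamEquiv k X Y)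
    (hX : TSat M φ X) : TSat M φ Y := by
  induction φ generalizing X Y with
  | rel r v =>
    intro t ht
    obtain ⟨s, hs, e⟩ := h.2 t ht
    rw [← funext fun i => e (v i) (hφ ⟨i, rfl⟩)]
    exact hX s hs
  | nrel r v =>
    intro t ht
    obtain ⟨s, hs, e⟩ := h.2 t ht
    rw [← funext fun i => e (v i) (hφ ⟨i, rfl⟩)]
    exact hX s hs
  | eq m n =>
    intro t ht
    obtain ⟨s, hs, e⟩ := h.2 t ht
    rw [← e m (hφ (.inl rfl)), ← e n (hφ (.inr rfl))]
    exact hX s hs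
  | neq m n =>
    intro t ht
    obtain ⟨s, hs, e⟩ := h.2 t ht
    rw [← e m (hφ (.inl rfl)), ← e n (hφ (.inr rfl))]
    exact hX s hs
  | and φ ψ ih₁ ih₂ =>
    rw [Vars, Set.union_subset_iff] at hφ
    exact ⟨ih₁ hφ.1 h hX.1, ih₂ hφ.2 h hX.2⟩
  | or φ ψ ih₁ ih₂ =>
    rw [Vars, Set.union_subset_iff] at hφ
    obtain ⟨X₁, X₂, rfl, h₁, h₂⟩ := hX
    refine ⟨{t ∈ Y | ∃ s ∈ X₁, ∀ n < k, s n = t n}, {t ∈ Y | ∃ s ∈ X₂, ∀ n < k, s n = t n},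
      ?_, ih₁ hφ.1 ⟨fun s hs => ?_, fun t ht => ht.2⟩ h₁,
      ih₂ hφ.2 ⟨fun s hs => ?_, fun t ht => ht.2⟩ h₂⟩
    · ext t
      constructor
      · intro ht
        obtain ⟨s, hs | hs, e⟩ := h.2 t ht
        · exact .inl ⟨ht, s, hs, e⟩
        · exact .inr ⟨ht, s, hs, e⟩
      · rintro (ht | ht) <;> exact ht.1
    · obtain ⟨t, ht, e⟩ := h.1 s (.inl hs)
      exact ⟨t, ⟨ht, s, hs, e⟩, e⟩
    · obtain ⟨t, ht, e⟩ := h.1 s (.inr hs)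
      exact ⟨t, ⟨ht, s, hs, e⟩, e⟩
  | ex x φ ih =>
    rw [Vars, Set.insert_subset_iff] at hφ
    obtain ⟨F, hF, hX⟩ := hX
    refine ⟨fun t => {a | ∃ s ∈ X, (∀ n < k, s n = t n) ∧ a ∈ F s}, fun t ht => ?_,
      ih hφ.2 ⟨?_, ?_⟩ hX⟩
    · obtain ⟨s, hs, e⟩ := h.2 t ht
      exact (hF s hs).imp fun a ha => ⟨s, hs, e, ha⟩
    · rintro _ ⟨s, hs, a, ha, rfl⟩
      obtain ⟨t, ht, e⟩ := h.1 s hs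
      exact ⟨_, ⟨t, ht, a, ⟨s, hs, e, ha⟩, rfl⟩, upd_agree e x a⟩
    · rintro _ ⟨t, ht, a, ⟨s, hs, e, ha⟩, rfl⟩
      exact ⟨_, ⟨s, hs, a, ha, rfl⟩, upd_agree e x a⟩
  | all x φ ih =>
    rw [Vars, Set.insert_subset_iff] at hφ
    refine ih hφ.2 ⟨?_, ?_⟩ hX
    · rintro _ ⟨s, hs, a, rfl⟩
      obtain ⟨t, ht, e⟩ := h.1 s hs
      exact ⟨_, ⟨t, ht, a, rfl⟩, upd_agree e x a⟩
    · rintro _ ⟨t, ht, a, rfl⟩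
      obtain ⟨s, hs, e⟩ := h.2 t ht
      exact ⟨_, ⟨s, hs, a, rfl⟩, upd_agree e x a⟩
  | atom i v =>
    have : (fun j => relOf X (v j)) = fun j => relOf Y (v j) :=
      funext fun j => h.relOf_eq fun l => hφ (Set.mem_iUnion.2 ⟨j, l, rfl⟩)
    rw [TSat] at hX ⊢
    rwa [← this]

/-- The team of all assignments whose restriction to the first `k` variables lies in `W`. -/
def cyl {A : Type} {k : ℕ} (W : Set (Fin k → A)) : Set (ℕ → A) :=
  {s | (fun i : Fin k => s i) ∈ W}

/-- The restriction of a team to the first `k` variables, as a relation. -/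
def restr {A : Type} (k : ℕ) (X : Set (ℕ → A)) : Set (Fin k → A) :=
  relOf X (fun i : Fin k => (i : ℕ))

theorem mem_cyl_restr {A : Type} {k : ℕ} {X : Set (ℕ → A)} {t : ℕ → A} :
    t ∈ cyl (restr k X) ↔ ∃ s ∈ X, ∀ n < k, s n = t n := by
  constructor
  · rintro ⟨s, hs, e⟩
    exact ⟨s, hs, fun n hn => congrFun e ⟨n, hn⟩⟩
  · rintro ⟨s, hs, e⟩
    exact ⟨s, hs, funext fun i => e i i.2⟩

theorem mem_cyl_of_agree {A : Type} {k : ℕ} {W : Set (Fin k → A)} {s t : ℕ → A}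
    (h : ∀ n < k, s n = t n) (hs : s ∈ cyl W) : t ∈ cyl W := by
  have : (fun i : Fin k => s i) = fun i : Fin k => t i := funext fun i => h i i.2
  rw [cyl, Set.mem_ofPred_eq] at hs ⊢
  rwa [← this]

theorem teamEquiv_cyl_restr {A : Type} {k : ℕ} (X : Set (ℕ → A)) :
    TeamEquiv k X (cyl (restr k X)) :=
  ⟨fun s hs => ⟨s, mem_cyl_restr.2 ⟨s, hs, fun _ _ => rfl⟩, fun _ _ => rfl⟩,
    fun _ ht => mem_cyl_restr.1 ht⟩

theorem tSat_or_cyl {M : Struc σ} {k : ℕ} {φ ψ : Fml σ ga} (hφ : Vars φ ⊆ {n : ℕ | n < k})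
    (hψ : Vars ψ ⊆ {n : ℕ | n < k}) (W : Set (Fin k → M.A)) :
    TSat M (.or φ ψ) (cyl W) ↔ ∃ U V : Set (Fin k → M.A),
      (∀ s, s ∈ cyl W ↔ s ∈ cyl U ∨ s ∈ cyl V) ∧ TSat M φ (cyl U) ∧ TSat M ψ (cyl V) := by
  constructor
  · rintro ⟨Y, Z, e, hY, hZ⟩
    refine ⟨restr k Y, restr k Z, fun s => ⟨fun hs => ?_, ?_⟩,
      hY.of_teamEquiv hφ (teamEquiv_cyl_restr Y), hZ.of_teamEquiv hψ (teamEquiv_cyl_restr Z)⟩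
    · rw [e] at hs
      exact hs.imp (fun h => mem_cyl_restr.2 ⟨s, h, fun _ _ => rfl⟩)
        (fun h => mem_cyl_restr.2 ⟨s, h, fun _ _ => rfl⟩)
    · rintro (hs | hs)
      · obtain ⟨t, ht, h⟩ := mem_cyl_restr.1 hs
        exact mem_cyl_of_agree h (e ▸ .inl ht)
      · obtain ⟨t, ht, h⟩ := mem_cyl_restr.1 hs
        exact mem_cyl_of_agree h (e ▸ .inr ht)
  · rintro ⟨U, V, h, hU, hV⟩
    exact ⟨cyl U, cyl V, Set.ext h, hU, hV⟩

theorem upd_upd_self {A : Type} (s : ℕ → A) (x : ℕ) (a : A) : upd (upd s x a) x (s x) = s := by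
  funext n
  by_cases h : n = x <;> simp [upd, h]

theorem agree_upd_of_agree_upd {A : Type} {k x : ℕ} {s t : ℕ → A} {a : A}
    (h : ∀ n < k, upd s x a n = t n) : ∀ n < k, s n = upd t x (s x) n := by
  intro n hn
  by_cases hx : n = x
  · simp [upd, hx]
  · simpa [upd, hx] using h n hn

theorem tSat_ex_cyl {M : Struc σ} {k x : ℕ} {φ : Fml σ ga} (hφ : Vars φ ⊆ {n : ℕ | n < k})
    (W : Set (Fin k → M.A)) :
    TSat M (.ex x φ) (cyl W) ↔ ∃ V : Set (Fin k → M.A),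
      (∀ s, (s ∈ cyl W → ∃ a, upd s x a ∈ cyl V) ∧ (s ∈ cyl V → ∃ a, upd s x a ∈ cyl W)) ∧
        TSat M φ (cyl V) := by
  constructor
  · rintro ⟨F, hF, h⟩
    refine ⟨_, fun s => ⟨fun hs => ?_, fun hs => ?_⟩, h.of_teamEquiv hφ (teamEquiv_cyl_restr _)⟩
    · obtain ⟨a, ha⟩ := hF s hs
      exact ⟨a, mem_cyl_restr.2 ⟨_, ⟨s, hs, a, ha, rfl⟩, fun _ _ => rfl⟩⟩
    · obtain ⟨_, ⟨t, ht, a, _, rfl⟩, e⟩ := mem_cyl_restr.1 hs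
      exact ⟨t x, mem_cyl_of_agree (agree_upd_of_agree_upd e) ht⟩
  · rintro ⟨V, hV, h⟩
    refine ⟨fun s => {a | upd s x a ∈ cyl V}, fun s => (hV s).1, ?_⟩
    convert h using 1
    ext s
    constructor
    · rintro ⟨t, _, a, ha, rfl⟩
      exact ha
    · intro hs
      obtain ⟨a, ha⟩ := (hV s).2 hs
      refine ⟨_, ha, s x, ?_, (upd_upd_self s x a).symm⟩
      rw [Set.mem_ofPred_eq, upd_upd_self]
      exact hs

theorem tSat_all_cyl {M : Struc σ} {k x : ℕ} {φ : Fml σ ga} (hφ : Vars φ ⊆ {n : ℕ | n < k})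
    (W : Set (Fin k → M.A)) :
    TSat M (.all x φ) (cyl W) ↔ ∃ V : Set (Fin k → M.A),
      (∀ s, s ∈ cyl V ↔ ∃ a, upd s x a ∈ cyl W) ∧ TSat M φ (cyl V) := by
  constructor
  · intro h
    refine ⟨_, fun s => ⟨fun hs => ?_, ?_⟩,
      TSat.of_teamEquiv hφ (teamEquiv_cyl_restr _) h⟩
    · obtain ⟨_, ⟨t, ht, a, rfl⟩, e⟩ := mem_cyl_restr.1 hs
      exact ⟨t x, mem_cyl_of_agree (agree_upd_of_agree_upd e) ht⟩
    · rintro ⟨a, ha⟩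
      exact mem_cyl_restr.2 ⟨s, ⟨_, ha, s x, (upd_upd_self s x a).symm⟩, fun _ _ => rfl⟩
  · rintro ⟨V, hV, h⟩
    rw [TSat]
    convert h using 1
    ext s
    rw [hV]
    constructor
    · rintro ⟨t, ht, a, rfl⟩
      refine ⟨t x, ?_⟩
      rwa [upd_upd_self]
    · rintro ⟨a, ha⟩
      exact ⟨_, ha, s x, (upd_upd_self s x a).symm⟩

/-- A characterisation, by quantifying over assignments of `k` variables only, of the relation
that a team induces via a tuple of variables. -/
theorem eq_relOf_cyl_iff {A : Type} [Nonempty A] {k m : ℕ} (W : Set (Fin k → A))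
    {v : Fin m → ℕ} (B : Set (Fin m → A)) :
    B = relOf (cyl W) v ↔ ∀ s : ℕ → A,
      (s ∈ cyl W → (fun i => s (v i)) ∈ B) ∧
      ((fun i => s (v i)) ∈ B → ∃ s', (∀ n, n ∉ Finset.range k \ Finset.univ.image v →
        s' n = s n) ∧ s' ∈ cyl W) ∧
      ((fun i : Fin m => s i) ∈ B → ∀ p q : Fin m, v p = v q → s p = s q) := by
  classical
  constructor
  · rintro rfl s
    refine ⟨fun hs => ⟨s, hs, rfl⟩, ?_, ?_⟩
    · rintro ⟨t, ht, e⟩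
      refine ⟨fun n => if n < k then t n else s n, fun n hn => ?_,
        mem_cyl_of_agree (fun n hn => by simp [hn]) ht⟩
      by_cases hnk : n < k
      · simp only [Finset.mem_sdiff, Finset.mem_range, hnk, true_and, not_not,
          Finset.mem_image, Finset.mem_univ] at hn
        obtain ⟨i, rfl⟩ := hn
        simpa [hnk] using congrFun e i
      · simp [hnk]
    · rintro ⟨t, _, e⟩ p q hpq
      rw [← congrFun e p, ← congrFun e q]
      exact congrArg t hpq
  · intro h
    ext u
    constructor
    · intro hu
      obtain ⟨a₀⟩ := ‹Nonempty A›
      let s : ℕ → A := fun n => if hn : n < m then u ⟨n, hn⟩ else a₀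
      have hs : (fun i : Fin m => s i) = u := funext fun i => by simp [s]
      have hfac : ∀ p q : Fin m, v p = v q → u p = u q := by
        intro p q hpq
        rw [← hs]
        exact (h s).2.2 (hs.symm ▸ hu) p q hpq
      let t : ℕ → A := fun n => if hn : ∃ i, v i = n then u hn.choose else a₀
      have ht : (fun i => t (v i)) = u := by
        funext i
        have hi : ∃ i', v i' = v i := ⟨i, rfl⟩
        simp only [t, dif_pos hi]
        exact hfac _ _ hi.choose_spec
      obtain ⟨s', hs', hW⟩ := (h t).2.1 (ht.symm ▸ hu)
      refine ⟨s', hW, ?_⟩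
      rw [← ht]
      exact funext fun i => hs' _ (by simp)
    · rintro ⟨s, hs, rfl⟩
      exact (h s).1 hs

theorem FODef.mem_cyl {τ : Signature} {k : ℕ} {J : Type} (j : J) :
    FODef τ k J (fun _ R s => s ∈ cyl (R j (Fin.last k))) :=
  FODef.mem j (Fin.last k) (fun i => (i : ℕ)) fun i => i.2

/-- The condition of `eq_relOf_cyl_iff` is definable in `FOC^k`. -/
theorem FODef.relOf_cyl {τ : Signature} {k : ℕ} (hk : 0 < k) {J : Type} (j j' : J)
    (m : Fin (k + 1)) {v : Fin m → ℕ} (hv : ∀ i, v i < k) :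
    FODef τ k J (fun _ R s =>
      (s ∈ cyl (R j (Fin.last k)) → (fun i => s (v i)) ∈ R j' m) ∧
      ((fun i => s (v i)) ∈ R j' m → ∃ s', (∀ n, n ∉ Finset.range k \ Finset.univ.image v →
        s' n = s n) ∧ s' ∈ cyl (R j (Fin.last k))) ∧
      ((fun i : Fin m => s i) ∈ R j' m → ∀ p q : Fin m, v p = v q → s p = s q)) := by
  have hm (p : Fin m) : (p : ℕ) < k := p.2.trans_le (Nat.lt_succ_iff.1 m.2)
  refine ((FODef.mem_cyl j).imp (.mem j' m v hv)).and
    (((FODef.mem j' m v hv).imp (.exFinset _ ?_ (.mem_cyl j))).and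
      ((FODef.mem j' m (fun i => (i : ℕ)) hm).imp ?_))
  · intro x hx
    exact Finset.mem_range.1 (Finset.mem_sdiff.1 hx).1
  · exact .forallFinite hk fun p => .forallFinite hk fun q => .constImp hk _ fun _ =>
      .eq (hm p) (hm q)

/-- The quantifier of a definable atom is definable in `Σ¹₁(FOC^k)` over any signature. -/
theorem DefinableAtom.soDef {G : GenAtom} {k : ℕ} (hdef : DefinableAtom G k)
    (hty : ∀ j, G.ty j ≤ k) (τ : Signature) :
    SODef τ k (Fin G.t)
      (fun M R => G.Q M.A (fun j => R j ⟨G.ty j, Nat.lt_succ_of_le (hty j)⟩)) := by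
  obtain ⟨m, ar, har, χ, hv, hχ⟩ := hdef
  let g : (expandSig (atomSig G) m ar).Rel → (famSig τ k (Fin G.t ⊕ Fin m)).Rel := fun r =>
    match r with
    | .inl j => .inr (.inl j, ⟨G.ty j, Nat.lt_succ_of_le (hty j)⟩)
    | .inr i => .inr (.inr i, ⟨ar i, Nat.lt_succ_of_le (har i)⟩)
  have hg : ∀ r, (famSig τ k (Fin G.t ⊕ Fin m)).arity (g r) =
      (expandSig (atomSig G) m ar).arity r := by
    rintro (r | p) <;> rfl
  refine ⟨Fin m, inferInstance, fun M R s => CSat (famStruc M R) (χ.mapRel g hg) s,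
    ⟨χ.mapRel g hg, (cVars_mapRel g hg χ).trans hv, fun _ _ _ => Iff.rfl⟩, fun M hM R => ?_⟩
  have key (S : Fin m → RelFam k M.A) (T : (i : Fin m) → Set (Fin (ar i) → M.A))
      (h : ∀ i, S i ⟨ar i, Nat.lt_succ_of_le (har i)⟩ = T i) (s : ℕ → M.A) :
      CSat (famStruc M (Sum.elim R S)) (χ.mapRel g hg) s ↔
        CSat (expandStruc (atomStruc G M.A
          (fun j => R j ⟨G.ty j, Nat.lt_succ_of_le (hty j)⟩)) m ar T) χ s := by
    refine (cSat_mapRel g hg (famStruc M (Sum.elim R S)) χ s).trans ?_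
    refine iff_of_eq (congrArg
      (fun I' => CSat (Struc.mk (σ := expandSig (atomSig G) m ar) M.A I') χ s) (funext ?_))
    rintro (j | i)
    · rfl
    · funext w
      exact congrArg (w ∈ ·) (h i)
  refine (hχ M.A hM _).trans ?_
  constructor
  · rintro ⟨T, hT⟩
    refine ⟨fun i n => {w | ∃ h : ar i = n, (fun l => w (Fin.cast h l)) ∈ T i}, fun s =>
      (key _ T (fun i => ?_) s).2 (hT s)⟩
    ext w
    exact ⟨fun ⟨_, h⟩ => h, fun h => ⟨rfl, h⟩⟩
  · rintro ⟨S, hS⟩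
    exact ⟨_, fun s => (key S _ (fun _ => rfl) s).1 (hS s)⟩

/-- Relation families realising prescribed relations of arity at most `k`. -/
theorem exists_relFam {k : ℕ} {A : Type} {m : Fin (k + 1)} (B : Set (Fin m → A)) :
    ∃ T : RelFam k A, T m = B :=
  ⟨Function.update (fun _ => ∅) m B, Function.update_self ..⟩

/-- Satisfaction in the team coded by a `k`-ary relation is definable in `Σ¹₁(FOC^k)`. -/
theorem soDef_tSat {k : ℕ} (hk : 1 ≤ k) {G : GenAtom} (hty : ∀ j, G.ty j ≤ k)
    (hdef : DefinableAtom G k) (φ : Fml σ (fun _ : Unit => G))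
    (hφ : Vars φ ⊆ {n : ℕ | n < k}) :
    SODef σ k Unit (fun M R => TSat M φ (cyl (R () (Fin.last k)))) := by
  induction φ with
  | rel r v =>
    exact .ofFODef ((FODef.mem_cyl ()).imp (.rel r v fun i => hφ ⟨i, rfl⟩))
  | nrel r v =>
    exact .ofFODef ((FODef.mem_cyl ()).imp (FODef.rel r v fun i => hφ ⟨i, rfl⟩).not)
  | eq m n =>
    exact .ofFODef ((FODef.mem_cyl ()).imp (.eq (hφ (.inl rfl)) (hφ (.inr rfl))))
  | neq m n =>
    exact .ofFODef ((FODef.mem_cyl ()).imp (FODef.eq (hφ (.inl rfl)) (hφ (.inr rfl))).not)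
  | and φ ψ ih₁ ih₂ =>
    rw [Vars, Set.union_subset_iff] at hφ
    exact (ih₁ hφ.1).and (ih₂ hφ.2)
  | or φ ψ ih₁ ih₂ =>
    rw [Vars, Set.union_subset_iff] at hφ
    refine SODef.congr (SODef.ex (K := Bool)
      ((SODef.ofFODef ((FODef.mem_cyl (.inl ())).iff
        ((FODef.mem_cyl (.inr false)).or (FODef.mem_cyl (.inr true))))).and
        (((ih₁ hφ.1).rename fun _ => .inr false).and
          ((ih₂ hφ.2).rename fun _ => .inr true)))) fun M _ R => ?_
    rw [tSat_or_cyl hφ.1 hφ.2]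
    constructor
    · rintro ⟨T, h⟩
      exact ⟨_, _, h⟩
    · rintro ⟨U, V, h⟩
      obtain ⟨T, rfl⟩ := exists_relFam (m := Fin.last k) U
      obtain ⟨T', rfl⟩ := exists_relFam (m := Fin.last k) V
      exact ⟨fun b => if b then T' else T, h⟩
  | ex x φ ih =>
    rw [Vars, Set.insert_subset_iff] at hφ
    refine SODef.congr (SODef.ex (K := Unit)
      ((SODef.ofFODef
        (((FODef.mem_cyl (.inl ())).imp (.ex hφ.1 (.mem_cyl (.inr ())))).and
          ((FODef.mem_cyl (.inr ())).imp (.ex hφ.1 (.mem_cyl (.inl ())))))).and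
        ((ih hφ.2).rename fun _ => .inr ()))) fun M _ R => ?_
    rw [tSat_ex_cyl hφ.2]
    constructor
    · rintro ⟨T, h⟩
      exact ⟨_, h⟩
    · rintro ⟨V, h⟩
      obtain ⟨T, rfl⟩ := exists_relFam (m := Fin.last k) V
      exact ⟨fun _ => T, h⟩
  | all x φ ih =>
    rw [Vars, Set.insert_subset_iff] at hφ
    refine SODef.congr (SODef.ex (K := Unit)
      ((SODef.ofFODef ((FODef.mem_cyl (.inr ())).iff (.ex hφ.1 (.mem_cyl (.inl ()))))).and
        ((ih hφ.2).rename fun _ => .inr ()))) fun M _ R => ?_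
    rw [tSat_all_cyl hφ.2]
    constructor
    · rintro ⟨T, h⟩
      exact ⟨_, h⟩
    · rintro ⟨V, h⟩
      obtain ⟨T, rfl⟩ := exists_relFam (m := Fin.last k) V
      exact ⟨fun _ => T, h⟩
  | atom i v =>
    have hv (j) (l) : v j l < k := hφ (Set.mem_iUnion.2 ⟨j, l, rfl⟩)
    refine SODef.congr (SODef.ex (K := Fin G.t)
      ((SODef.ofFODef (FODef.forallFinite hk fun j : Fin G.t =>
        FODef.relOf_cyl hk (.inl ()) (.inr j) ⟨G.ty j, Nat.lt_succ_of_le (hty j)⟩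
          (hv j))).and
        ((hdef.soDef hty σ).rename .inr))) fun M hM R => ?_
    have key (T : Fin G.t → RelFam k M.A) :
        (∀ j, T j ⟨G.ty j, Nat.lt_succ_of_le (hty j)⟩ =
          relOf (cyl (R () (Fin.last k))) (v j)) ↔ _ :=
      (forall_congr' fun j => eq_relOf_cyl_iff _ _).trans forall_comm
    rw [TSat]
    constructor
    · rintro ⟨T, h, hQ⟩
      rw [← funext ((key T).2 h)]
      exact hQ
    · intro hQ
      choose T hT using fun j => exists_relFam
        (m := ⟨G.ty j, Nat.lt_succ_of_le (hty j)⟩) (relOf (cyl (R () (Fin.last k))) (v j))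
      refine ⟨T, (key T).1 hT, ?_⟩
      rw [← funext hT] at hQ
      exact hQ

/-- Theorem 6 of the paper: for every `k ≥ 1` and every
generalized atom `A_Q` of type `(i_1,...,i_t)` with all `i_j ≤ k` that is
definable in `Σ¹₁(FOC^k)`, every sentence `φ` of `FO^k(A_Q)` (variables among
`x_1,...,x_k`, i.e. `0,...,k-1`) is equivalent to a `Σ¹₁(FOC^k)` sentence
`∃R_1⋯∃R_n χ` (all arities at most `k`): for every structure `M` with
nonempty domain, `M ⊨ φ` in team semantics iff `∃R_1⋯∃R_n χ` is true in `M`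
in the Tarskian sense. -/
theorem fo_k_atom_to_sigma11_fock (k : ℕ) (hk : 1 ≤ k) (σ : Signature)
    (G : GenAtom) (hty : ∀ j, G.ty j ≤ k) (hdef : DefinableAtom G k)
    (φ : Fml σ (fun _ : Unit => G))
    (hvars : Vars φ ⊆ {n : ℕ | n < k}) (hsen : Fr φ = ∅) :
    ∃ (n : ℕ) (ar : Fin n → ℕ), (∀ i, ar i ≤ k) ∧
      ∃ χ : CFml (expandSig σ n ar), CVars χ ⊆ {n : ℕ | n < k} ∧
        ∀ M : Struc σ, Nonempty M.A →
          (TTrue M φ ↔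
            ∃ R : (i : Fin n) → Set (Fin (ar i) → M.A),
              ∀ s : ℕ → M.A, CSat (expandStruc M n ar R) χ s) := by
  refine SODef.exists_sentence (SODef.congr (SODef.ex (K := Unit)
    ((SODef.ofFODef (FODef.mem_cyl (.inr ()))).and
      ((soDef_tSat hk hty hdef φ hvars).rename fun _ => .inr ()))) fun M _ R => ?_)
  constructor
  · rintro ⟨T, h, hT⟩
    rw [TTrue, ← Set.eq_univ_of_forall h]
    exact hT
  · intro h
    exact ⟨fun _ _ => Set.univ, fun _ => Set.mem_univ _, h⟩
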